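/- arXiv:1902.01472 — 4 statements merged into one kernel-verified Lean document; each statement's English description precedes it below -/
import Mathlib

section
/- Let m and n be positive integers with n > 3m, and let F = {k ∈ ℤ : |k| ≤ m}. If H is a subgroup of ℤ such that H ⊆ F + nℤ and nℤ ⊆ F + H, then H = nℤ. (This witnesses that the subgroup hyperballean of ℤ is thin.) -/
open Pointwise

/-- For `0 < m` and `n > 3m`, with `F = {k : ℤ | |k| ≤ m}`: if `H` is a subgroup of
`ℤ` with `H ⊆ F + nℤ` and `nℤ ⊆ F + H`, then `H = nℤ`. -/
theorem subgroup_eq_nZ_of_close (m n : ℕ) (hm : 0 < m) (hn : 3 * m < n)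
    (H : AddSubgroup ℤ)
    (h1 : (H : Set ℤ) ⊆ {k : ℤ | |k| ≤ (m : ℤ)} +
      (AddSubgroup.zmultiples (n : ℤ) : Set ℤ))
    (h2 : (AddSubgroup.zmultiples (n : ℤ) : Set ℤ) ⊆
      {k : ℤ | |k| ≤ (m : ℤ)} + (H : Set ℤ)) :
    H = AddSubgroup.zmultiples (n : ℤ) := by
  have small : ∀ l : ℤ, |(n : ℤ) * l| ≤ 3 * m → l = 0 := by
    intro l hl
    by_contra h
    have h3 : 1 ≤ |l| := Int.one_le_abs h
    rw [abs_mul, Nat.abs_cast] at hl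
    have hn' : (3 * m : ℤ) < n := by exact_mod_cast hn
    nlinarith
  have key : ∀ h ∈ H, ∃ l : ℤ, h = n * l := by
    intro h hh
    obtain ⟨f, hf, y, hy, hfy⟩ := Set.mem_add.1 (h1 hh)
    obtain ⟨k, rfl⟩ := AddSubgroup.mem_zmultiples_iff.1 hy
    simp only [Set.mem_setOf_eq, smul_eq_mul] at hf hfy
    have ind : ∀ j : ℕ, |(j : ℤ) * f| ≤ m := by
      intro j
      induction j with
      | zero => simp
      | succ j ih =>
        have hj : ((j + 1 : ℕ) : ℤ) * h ∈ H := by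
          have := H.nsmul_mem hh (j + 1)
          rwa [nsmul_eq_mul] at this
        obtain ⟨g, hg, y, hy, hgy⟩ := Set.mem_add.1 (h1 hj)
        obtain ⟨q, rfl⟩ := AddSubgroup.mem_zmultiples_iff.1 hy
        simp only [Set.mem_setOf_eq, smul_eq_mul] at hg hgy
        have e : (n : ℤ) * (q - (j + 1) * k) = j * f + f - g := by
          rw [← hfy] at hgy
          push_cast at hgy
          linear_combination hgy
        have h0 := small (q - (j + 1) * k) (by
          rw [e]
          rw [abs_le] at *
          constructor <;> linarith [ih.1, ih.2, hf.1, hf.2, hg.1, hg.2])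
        rw [h0] at e
        have : ((j + 1 : ℕ) : ℤ) * f = g := by
          push_cast
          linear_combination -e
        rw [this]
        exact hg
    have hf0 : f = 0 := by
      by_contra hne
      have h3 : 1 ≤ |f| := Int.one_le_abs hne
      have h4 := ind (m + 1)
      rw [abs_mul, Nat.abs_cast] at h4
      push_cast at h4
      nlinarith
    exact ⟨k, by rw [← hfy, hf0]; ring⟩
  apply le_antisymm
  · intro h hh
    obtain ⟨l, hl⟩ := key h hh
    exact AddSubgroup.mem_zmultiples_iff.2 ⟨l, by rw [hl, smul_eq_mul]; ring⟩
  · rw [AddSubgroup.zmultiples_le]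
    obtain ⟨f, hf, h, hh, hfh⟩ := Set.mem_add.1 (h2 (AddSubgroup.mem_zmultiples (n : ℤ)))
    simp only [Set.mem_setOf_eq] at hf
    obtain ⟨l, hl⟩ := key h hh
    have e : (n : ℤ) * (1 - l) = f := by
      rw [hl] at hfh
      linear_combination -hfh
    have h0 := small (1 - l) (by rw [e]; linarith [abs_nonneg f])
    have hf0 : f = 0 := by rw [← e, h0, mul_zero]
    rw [hf0, zero_add] at hfh
    rw [← hfh]
    exact hh
end

section
/- Let n be a positive integer and let p₁, …, pₙ be pairwise distinct primes, each ≥ 3 (so that log pᵢ ≥ 1 for the natural logarithm). For n-tuples m̄, m̄' of natural numbers set D(m̄,m̄') = max( Σᵢ (log pᵢ)·max(mᵢ − mᵢ', 0), Σᵢ (log pᵢ)·max(mᵢ' − mᵢ, 0) ). Then for all m̄, m̄': Σᵢ |mᵢ − mᵢ'| ≤ n · D(m̄,m̄') and D(m̄,m̄') ≤ (maxᵢ log pᵢ) · Σᵢ |mᵢ − mᵢ'|. (Hence the map (m₁,…,mₙ) ↦ p₁^{m₁}⋯pₙ^{mₙ}ℤ is an asymorphism of ℕⁿ with the taxi-driver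 metric onto its image in the subgroup logarithmic hyperballean of ℤ.) -/
/-- For pairwise distinct primes `p₁,…,pₙ` each `≥ 3`, the taxi-driver metric on `ℕⁿ`
and the logarithmic distance `D(m̄,m̄') = max(Σ log pᵢ · (mᵢ-mᵢ')⁺, Σ log pᵢ · (mᵢ'-mᵢ)⁺)`
are bi-Lipschitz equivalent:
`Σ |mᵢ-mᵢ'| ≤ n · D(m̄,m̄')` and `D(m̄,m̄') ≤ (maxᵢ log pᵢ) · Σ |mᵢ-mᵢ'|`. -/
theorem taxi_metric_equiv_log_metric
    (n : ℕ) (hn : 0 < n) (p : Fin n → ℕ) (hp : ∀ i, (p i).Prime)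
    (hinj : Function.Injective p) (h3 : ∀ i, 3 ≤ p i) (m m' : Fin n → ℕ) :
    (∑ i, |(m i : ℝ) - (m' i : ℝ)|) ≤
      n * max (∑ i, Real.log (p i) * max ((m i : ℝ) - (m' i : ℝ)) 0)
              (∑ i, Real.log (p i) * max ((m' i : ℝ) - (m i : ℝ)) 0) ∧
    max (∑ i, Real.log (p i) * max ((m i : ℝ) - (m' i : ℝ)) 0)
        (∑ i, Real.log (p i) * max ((m' i : ℝ) - (m i : ℝ)) 0) ≤
      (⨆ i, Real.log (p i)) * ∑ i, |(m i : ℝ) - (m' i : ℝ)| := by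
  have hlog : ∀ i, 1 ≤ Real.log (p i) := by
    intro i
    have h : (3 : ℝ) ≤ p i := by exact_mod_cast h3 i
    rw [Real.le_log_iff_exp_le (by linarith)]
    linarith [Real.exp_one_lt_d9]
  have key : ∀ a b : Fin n → ℕ, ∀ i, (a i : ℝ) - b i ≤
      ∑ j, Real.log (p j) * max ((a j : ℝ) - (b j : ℝ)) 0 := by
    intro a b i
    have h1 := Finset.single_le_sum
      (f := fun j => Real.log (p j) * max ((a j : ℝ) - (b j : ℝ)) 0)
      (fun j _ => mul_nonneg (by linarith [hlog j]) (le_max_right _ _)) (Finset.mem_univ i)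
    have h2 := le_mul_of_one_le_left (le_max_right ((a i : ℝ) - (b i : ℝ)) 0) (hlog i)
    have h3 := le_max_left ((a i : ℝ) - (b i : ℝ)) 0
    exact h3.trans (h2.trans h1)
  have hs : ∀ i, Real.log (p i) ≤ ⨆ i, Real.log (p i) := fun i =>
    le_ciSup (f := fun i => Real.log (p i)) (Set.finite_range _).bddAbove i
  constructor
  · have h := Finset.sum_le_card_nsmul Finset.univ (fun i => |(m i : ℝ) - (m' i : ℝ)|)
      (max (∑ i, Real.log (p i) * max ((m i : ℝ) - (m' i : ℝ)) 0)
              (∑ i, Real.log (p i) * max ((m' i : ℝ) - (m i : ℝ)) 0)) (by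
        intro i _
        refine abs_le'.2 ⟨(key m m' i).trans (le_max_left _ _), ?_⟩
        rw [neg_sub]
        exact (key m' m i).trans (le_max_right _ _))
    simpa using h
  · rw [Finset.mul_sum]
    refine max_le (Finset.sum_le_sum fun i _ => ?_) (Finset.sum_le_sum fun i _ => ?_)
    · exact mul_le_mul (hs i) (max_le (le_abs_self _) (abs_nonneg _)) (le_max_right _ _)
        (by linarith [hs i, hlog i])
    · rw [abs_sub_comm]
      exact mul_le_mul (hs i) (max_le (le_abs_self _) (abs_nonneg _)) (le_max_right _ _)
        (by linarith [hs i, hlog i])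
end

section
/- Let G be a group, let 𝓗 be a family of subgroups of G that is stable under finite (binary) intersections, and suppose there exists a natural number n such that [G : H] ≤ n for every H ∈ 𝓗. Then 𝓗 is finite. -/
/-- If a family `𝓗` of subgroups of `G` is stable under binary intersections and
all of its members have (finite) index at most `n`, then `𝓗` is finite. -/
theorem finite_family_of_bounded_index {G : Type*} [Group G]
    (𝓗 : Set (Subgroup G))
    (hstab : ∀ H ∈ 𝓗, ∀ K ∈ 𝓗, H ⊓ K ∈ 𝓗)
    (n : ℕ) (hidx : ∀ H ∈ 𝓗, H.index ≠ 0 ∧ H.index ≤ n) :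
    𝓗.Finite := by
  rcases 𝓗.eq_empty_or_nonempty with rfl | hne
  · exact Set.finite_empty
  have hfin : (Subgroup.index '' 𝓗).Finite :=
    (Set.finite_Iic n).subset (by rintro _ ⟨H, hH, rfl⟩; exact (hidx H hH).2)
  obtain ⟨M, hM, hmax⟩ := Set.exists_max_image _ id hfin (hne.image _)
  obtain ⟨H₀, hH₀, rfl⟩ := hM
  have hle : ∀ H ∈ 𝓗, H₀ ≤ H := by
    intro H hH
    by_contra hnot
    have hmem := hstab H₀ hH₀ H hH
    haveI : (H₀ ⊓ H).FiniteIndex := ⟨(hidx _ hmem).1⟩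
    have hlt : H₀ ⊓ H < H₀ := inf_lt_left.2 hnot
    have h1 := Subgroup.index_strictAnti hlt
    have h2 : (H₀ ⊓ H).index ≤ H₀.index := hmax _ ⟨_, hmem, rfl⟩
    omega
  haveI : H₀.FiniteIndex := ⟨(hidx _ hH₀).1⟩
  refine Set.Finite.of_finite_image
    (f := fun H : Subgroup G => (QuotientGroup.mk '' (H : Set G) : Set (G ⧸ H₀)))
    (Set.toFinite _) ?_
  have key : ∀ H ∈ 𝓗, ∀ K ∈ 𝓗,
      (QuotientGroup.mk '' (H : Set G) : Set (G ⧸ H₀)) = QuotientGroup.mk '' (K : Set G) →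
      H ≤ K := by
    intro H _ K hK h x hx
    have hx' : (QuotientGroup.mk x : G ⧸ H₀) ∈ (QuotientGroup.mk '' (K : Set G) : Set (G ⧸ H₀)) :=
      h ▸ ⟨x, hx, rfl⟩
    obtain ⟨y, hy, hyx⟩ := hx'
    have h3 := hle K hK (QuotientGroup.eq.1 hyx)
    simpa using K.mul_mem hy h3
  intro H hH K hK h
  exact le_antisymm (key H hH K hK h) (key K hK H hH h.symm)
end

section
/- Let G be a group with identity e, let R be a natural number, and let X, Y be nonempty finite subsets of G with |X △ Y| ≤ R (symmetric difference of cardinality at most R). Then there exist finite subsets F and K of G with e ∈ F, e ∈ K, |F| ≤ R + 1, |K| ≤ R + 1, such that X ⊆ FY and Y ⊆ KX. (Hence the Hamming ballean on the finite subsets of G is finer than the logarithmic hyperballean restricted to them.) -/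
open Pointwise

theorem hamming_cover_aux {G : Type*} [Group G] [DecidableEq G]
    (R : ℕ) (X Y : Finset G) (hY : Y.Nonempty)
    (h : (symmDiff X Y).card ≤ R) :
    ∃ F : Finset G, (1 : G) ∈ F ∧ F.card ≤ R + 1 ∧
      (X : Set G) ⊆ (F : Set G) * (Y : Set G) := by
  obtain ⟨y, hy⟩ := hY
  refine ⟨insert 1 ((X \ Y).image (fun x => x * y⁻¹)), Finset.mem_insert_self _ _, ?_, ?_⟩
  · refine (Finset.card_insert_le _ _).trans (Nat.succ_le_succ ?_)
    refine Finset.card_image_le.trans (le_trans (Finset.card_le_card ?_) h)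
    intro x hx
    rw [Finset.mem_sdiff] at hx
    exact Finset.mem_symmDiff.2 (Or.inl hx)
  · intro x hx
    by_cases hxY : x ∈ Y
    · exact Set.mem_mul.2 ⟨1, by simp, x, hxY, one_mul x⟩
    · refine Set.mem_mul.2 ⟨x * y⁻¹, ?_, y, hy, by simp⟩
      exact Finset.mem_coe.2 (Finset.mem_insert_of_mem
        (Finset.mem_image.2 ⟨x, Finset.mem_sdiff.2 ⟨hx, hxY⟩, rfl⟩))

/-- If nonempty finite subsets `X, Y` of a group `G` satisfy `|X △ Y| ≤ R`, then
there are finite sets `F, K` containing the identity, of cardinality at most `R + 1`,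
with `X ⊆ FY` and `Y ⊆ KX`. -/
theorem hamming_finer_than_log_hyperballean {G : Type*} [Group G] [DecidableEq G]
    (R : ℕ) (X Y : Finset G) (hX : X.Nonempty) (hY : Y.Nonempty)
    (h : (symmDiff X Y).card ≤ R) :
    ∃ F K : Finset G, (1 : G) ∈ F ∧ (1 : G) ∈ K ∧
      F.card ≤ R + 1 ∧ K.card ≤ R + 1 ∧
      (X : Set G) ⊆ (F : Set G) * (Y : Set G) ∧
      (Y : Set G) ⊆ (K : Set G) * (X : Set G) := by
  obtain ⟨F, hF1, hFc, hF⟩ := hamming_cover_aux R X Y hY h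
  obtain ⟨K, hK1, hKc, hK⟩ := hamming_cover_aux R Y X hX (by rwa [symmDiff_comm])
  exact ⟨F, K, hF1, hK1, hFc, hKc, hF, hK⟩
end
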